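/- Let μ be a finite measure on ℝ^d that is absolutely continuous with respect to Lebesgue measure and satisfies ∫‖x‖² dμ(x) < ∞, let p₁, …, p_k ∈ ℝ^d be pairwise distinct, and let ν₁, …, ν_k be strictly positive real numbers with Σ_{i=1}^k ν_i = μ(ℝ^d). Then there exists a weight vector W = (w₁,…,w_k) ∈ ℝ^k such that μ(Pow_W(p_i)) = ν_i for every i; that is, the power diagram with weights W is adapted to the capacity constraints ν_i. -/

import Mathlib

open MeasureTheory

/-- The power cell of `p i` for the weight vector `W`. -/
def powerCell {d k : ℕ} (p : Fin k → EuclideanSpace ℝ (Fin d)) (W : Fin k → ℝ)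
    (i : Fin k) : Set (EuclideanSpace ℝ (Fin d)) :=
  {x | ∀ j : Fin k, j ≠ i → ‖x - p i‖ ^ 2 - W i < ‖x - p j‖ ^ 2 - W j}

open Filter Topology

theorem measurableSet_powerCell {d k : ℕ} (p : Fin k → EuclideanSpace ℝ (Fin d))
    (W : Fin k → ℝ) (i : Fin k) : MeasurableSet (powerCell p W i) := by
  have h : powerCell p W i =
      ⋂ j : Fin k, ⋂ _ : j ≠ i, {x | ‖x - p i‖ ^ 2 - W i < ‖x - p j‖ ^ 2 - W j} := by
    ext x
    simp [powerCell]
  rw [h]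
  exact MeasurableSet.iInter fun j => MeasurableSet.iInter fun _ =>
    measurableSet_lt (by fun_prop) (by fun_prop)

/-- Points with equal power distance to two distinct sites form a Lebesgue null set. -/
theorem volume_setOf_power_eq {d : ℕ} {a b : EuclideanSpace ℝ (Fin d)} (hab : a ≠ b)
    (s t : ℝ) :
    volume {x : EuclideanSpace ℝ (Fin d) | ‖x - a‖ ^ 2 - s = ‖x - b‖ ^ 2 - t} = 0 := by
  rcases Set.eq_empty_or_nonempty
    {x : EuclideanSpace ℝ (Fin d) | ‖x - a‖ ^ 2 - s = ‖x - b‖ ^ 2 - t} with h | ⟨y, hy⟩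
  · rw [h, measure_empty]
  · let f : EuclideanSpace ℝ (Fin d) →ₗ[ℝ] ℝ := (innerSL ℝ (a - b)).toLinearMap
    refine measure_mono_null (t := (AffineSubspace.mk' y f.ker : Set _)) ?_
      (Measure.addHaar_affineSubspace _ _ ?_)
    · intro x hx
      rw [SetLike.mem_coe, AffineSubspace.mem_mk', LinearMap.mem_ker]
      change inner ℝ (a - b) (x - y) = 0
      simp only [Set.mem_ofPred_eq, norm_sub_sq_real] at hx hy
      rw [inner_sub_left, inner_sub_right, inner_sub_right, real_inner_comm x a,
        real_inner_comm y a, real_inner_comm x b, real_inner_comm y b]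
      linarith
    · intro h
      have h' := congrArg AffineSubspace.direction h
      rw [AffineSubspace.direction_mk', AffineSubspace.direction_top] at h'
      have hm : a - b ∈ f.ker := h' ▸ Submodule.mem_top
      exact sub_ne_zero.2 hab (inner_self_eq_zero.1 (LinearMap.mem_ker.1 hm))

theorem ae_power_ne {d k : ℕ} {μ : Measure (EuclideanSpace ℝ (Fin d))} (hac : μ ≪ volume)
    {p : Fin k → EuclideanSpace ℝ (Fin d)} (hp : Function.Injective p) (W : Fin k → ℝ) :
    ∀ᵐ x ∂μ, ∀ i j, j ≠ i → ‖x - p i‖ ^ 2 - W i ≠ ‖x - p j‖ ^ 2 - W j := by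
  rw [ae_all_iff]; intro i
  rw [ae_all_iff]; intro j
  by_cases hij : j = i
  · simp [hij]
  · have h := hac (volume_setOf_power_eq (hp.ne (Ne.symm hij)) (W i) (W j))
    filter_upwards [measure_eq_zero_iff_ae_notMem.1 h] with x hx _
    exact hx

theorem continuous_measureReal_powerCell {d k : ℕ} {μ : Measure (EuclideanSpace ℝ (Fin d))}
    [IsFiniteMeasure μ] (hac : μ ≪ volume) {p : Fin k → EuclideanSpace ℝ (Fin d)}
    (hp : Function.Injective p) (i : Fin k) :
    Continuous fun W : Fin k → ℝ => μ.real (powerCell p W i) := by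
  rw [continuous_iff_continuousAt]
  intro W
  refine (ENNReal.tendsto_toReal (measure_ne_top μ _)).comp
    (tendsto_measure_of_ae_tendsto_indicator_of_isFiniteMeasure (𝓝 W)
      (measurableSet_powerCell p W i) (fun V => measurableSet_powerCell p V i) ?_)
  filter_upwards [ae_power_ne hac hp W] with x hx
  have h : ∀ᶠ V in 𝓝 W, ∀ j, j ≠ i →
      (‖x - p i‖ ^ 2 - V i < ‖x - p j‖ ^ 2 - V j ↔
        ‖x - p i‖ ^ 2 - W i < ‖x - p j‖ ^ 2 - W j) := by
    rw [eventually_all]; intro j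
    have hc : ∀ l : Fin k, ContinuousAt (fun V : Fin k → ℝ => ‖x - p l‖ ^ 2 - V l) W :=
      fun l => (continuous_const.sub (continuous_apply l)).continuousAt
    by_cases hj : j = i
    · simp [hj]
    · rcases lt_or_gt_of_ne (hx i j hj) with hlt | hlt
      · filter_upwards [(hc i).eventually_lt (hc j) hlt] with V hV _
        exact iff_of_true hV hlt
      · filter_upwards [(hc j).eventually_lt (hc i) hlt] with V hV _
        exact iff_of_false hV.not_gt hlt.not_gt
  filter_upwards [h] with V hV
  exact forall₂_congr hV

theorem sum_measureReal_powerCell {d k : ℕ} [NeZero k]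
    {μ : Measure (EuclideanSpace ℝ (Fin d))} [IsFiniteMeasure μ] (hac : μ ≪ volume)
    {p : Fin k → EuclideanSpace ℝ (Fin d)} (hp : Function.Injective p) (W : Fin k → ℝ) :
    ∑ i, μ.real (powerCell p W i) = μ.real Set.univ := by
  have hd : Pairwise (Function.onFun Disjoint (powerCell p W)) := by
    intro i j hij
    refine Set.disjoint_left.2 fun x hi hj => ?_
    exact (hi j hij.symm).not_gt (hj i hij)
  have hu : (⋃ i, powerCell p W i : Set _) =ᵐ[μ] Set.univ := by
    rw [ae_eq_univ_iff_measure_eq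
      (MeasurableSet.iUnion fun i => measurableSet_powerCell p W i).nullMeasurableSet]
    refine measure_congr (eventuallyEq_univ.2 ?_)
    filter_upwards [ae_power_ne hac hp W] with x hx
    obtain ⟨i, hi⟩ := Finite.exists_min fun i => ‖x - p i‖ ^ 2 - W i
    exact Set.mem_iUnion.2 ⟨i, fun j hj => lt_of_le_of_ne (hi j) (hx i j hj)⟩
  rw [← measureReal_congr hu, measureReal_iUnion_fintype hd (measurableSet_powerCell p W)]

theorem tendsto_measureReal_powerCell_tail {d : ℕ} (μ : Measure (EuclideanSpace ℝ (Fin d)))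
    [IsFiniteMeasure μ] (a b : EuclideanSpace ℝ (Fin d)) :
    Tendsto (fun M : ℝ => μ.real {x | ‖x - a‖ ^ 2 + M < ‖x - b‖ ^ 2}) atTop (𝓝 0) := by
  have h : Tendsto (fun M : ℝ => μ {x | ‖x - a‖ ^ 2 + M < ‖x - b‖ ^ 2}) atTop
      (𝓝 (μ (∅ : Set (EuclideanSpace ℝ (Fin d))))) := by
    refine tendsto_measure_of_ae_tendsto_indicator_of_isFiniteMeasure atTop
      MeasurableSet.empty (fun M => measurableSet_lt (by fun_prop) (by fun_prop)) ?_
    refine Eventually.of_forall fun x => ?_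
    filter_upwards [eventually_ge_atTop (‖x - b‖ ^ 2)] with M hM
    refine iff_of_false (fun hx => ?_) (Set.notMem_empty x)
    have hx' : ‖x - a‖ ^ 2 + M < ‖x - b‖ ^ 2 := hx
    nlinarith [sq_nonneg ‖x - a‖]
  simpa [Measure.real, Function.comp_def] using (ENNReal.tendsto_toReal (measure_ne_top μ _)).comp h

/-- There exists a weight vector `W` such that the power diagram with weights `W` is
adapted to the capacity constraints: `μ(Pow_W(p_i)) = ν_i` for all `i`. -/
theorem exists_adapted_power_diagram
    (d k : ℕ) (μ : Measure (EuclideanSpace ℝ (Fin d))) [IsFiniteMeasure μ]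
    (hac : μ ≪ volume) (hint : Integrable (fun x => ‖x‖ ^ 2) μ)
    (p : Fin k → EuclideanSpace ℝ (Fin d)) (hp : Function.Injective p)
    (ν : Fin k → ℝ) (hν : ∀ i, 0 < ν i)
    (hsum : ∑ i : Fin k, ν i = (μ Set.univ).toReal) :
    ∃ W : Fin k → ℝ, ∀ i : Fin k, (μ (powerCell p W i)).toReal = ν i := by
  rcases Nat.eq_zero_or_pos k with rfl | hk
  · exact ⟨0, fun i => i.elim0⟩
  have : NeZero k := ⟨hk.ne'⟩
  let z : Fin k := 0
  have hcont := continuous_measureReal_powerCell hac hp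
  have htot : ∀ W, ∑ i, μ.real (powerCell p W i) = ∑ i, ν i := fun W =>
    (sum_measureReal_powerCell hac hp W).trans hsum.symm
  obtain ⟨M, hM0, hM⟩ : ∃ M : ℝ, 0 ≤ M ∧
      ∀ i j, μ.real {x | ‖x - p i‖ ^ 2 + M < ‖x - p j‖ ^ 2} < ν i :=
    ((eventually_ge_atTop 0).and (eventually_all.2 fun i => eventually_all.2 fun j =>
      (tendsto_measureReal_powerCell_tail μ (p i) (p j)).eventually_lt_const (hν i))).exists
  have hbound : ∀ W : Fin k → ℝ, W z = 0 →
      (∀ i, i ≠ z → μ.real (powerCell p W i) ≤ ν i) → ∀ j, W j ≤ M := by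
    intro W hz hW j
    by_contra! hj
    have hjz : j ≠ z := by rintro rfl; linarith
    have hlt : μ.real (powerCell p W z) < ν z := by
      refine (measureReal_mono fun x hx => ?_).trans_lt (hM z j)
      have := hx j hjz
      change ‖x - p z‖ ^ 2 + M < ‖x - p j‖ ^ 2
      linarith
    refine (htot W).not_lt (Finset.sum_lt_sum (fun i _ => ?_) ⟨z, Finset.mem_univ z, hlt⟩)
    by_cases hi : i = z
    · exact hi ▸ hlt.le
    · exact hW i hi
  let K : Set (Fin k → ℝ) := Set.Icc (fun _ => -M) (fun _ => M) ∩
    {W | W z = 0 ∧ ∀ i, i ≠ z → μ.real (powerCell p W i) ≤ ν i}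
  have hK : IsCompact K := by
    have hcl : IsClosed {W : Fin k → ℝ | ∀ i, i ≠ z → μ.real (powerCell p W i) ≤ ν i} := by
      simp only [Set.ofPred_forall]
      exact isClosed_iInter fun i => isClosed_iInter fun _ =>
        isClosed_le (hcont i) continuous_const
    exact isCompact_Icc.inter_right
      ((isClosed_eq (continuous_apply z) continuous_const).inter hcl)
  have hne : K.Nonempty := by
    let V : Fin k → ℝ := fun i => if i = z then 0 else -M
    have hV : ∀ i, i ≠ z → V i = -M := fun i hi => if_neg hi
    have hVz : V z = 0 := if_pos rfl
    refine ⟨V, ⟨fun i => ?_, fun i => ?_⟩, hVz, fun i hi => ?_⟩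
    · dsimp only [V]; split_ifs <;> linarith
    · dsimp only [V]; split_ifs <;> linarith
    · refine (measureReal_mono fun x hx => ?_).trans (hM i z).le
      have := hx z hi.symm
      rw [hV i hi, hVz] at this
      change ‖x - p i‖ ^ 2 + M < ‖x - p z‖ ^ 2
      linarith
  obtain ⟨W, ⟨hWI, hWz, hWν⟩, hmax⟩ := hK.exists_isMaxOn hne
    (f := fun W => ∑ i, W i) (by fun_prop)
  have heq : ∀ i, i ≠ z → μ.real (powerCell p W i) = ν i := by
    intro i hi
    by_contra hcon
    have hlt := lt_of_le_of_ne (hWν i hi) hcon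
    have hup : Continuous fun t : ℝ => Function.update W i t :=
      continuous_const.update i continuous_id
    have hev : ∀ᶠ t in 𝓝 (W i), μ.real (powerCell p (Function.update W i t) i) < ν i :=
      ((hcont i).comp hup).continuousAt.eventually_lt_const
        (by simpa using hlt)
    obtain ⟨t, ht, hWt⟩ := ((hev.filter_mono nhdsWithin_le_nhds).and
      (self_mem_nhdsWithin : Set.Ioi (W i) ∈ 𝓝[>] (W i))).exists
    have hWt' : W i < t := hWt
    have hz : Function.update W i t z = 0 := by
      rw [Function.update_of_ne hi.symm, hWz]
    have hle : ∀ j, j ≠ z → μ.real (powerCell p (Function.update W i t) j) ≤ ν j := by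
      intro j hj
      by_cases hji : j = i
      · exact hji ▸ ht.le
      · refine (measureReal_mono fun x hx l hl => ?_).trans (hWν j hj)
        have h := hx l hl
        rw [Function.update_of_ne hji] at h
        by_cases hli : l = i
        · subst hli
          rw [Function.update_self] at h
          linarith
        · rwa [Function.update_of_ne hli] at h
    have hWle : W ≤ Function.update W i t := le_update_self_iff.2 hWt'.le
    have := hmax (show Function.update W i t ∈ K from
      ⟨⟨hWI.1.trans hWle, hbound _ hz hle⟩, hz, hle⟩)
    refine (Finset.sum_lt_sum (fun j _ => hWle j)
      ⟨i, Finset.mem_univ i, ?_⟩).not_ge this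
    rwa [Function.update_self]
  refine ⟨W, fun i => ?_⟩
  by_cases hi : i = z
  · have h := htot W
    rw [← Finset.add_sum_erase _ _ (Finset.mem_univ z),
      ← Finset.add_sum_erase _ ν (Finset.mem_univ z),
      Finset.sum_congr rfl fun j hj => heq j (Finset.ne_of_mem_erase hj)] at h
    exact hi ▸ add_right_cancel h
  · exact heq i hi
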